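/- arXiv:math/9604208 — 2 statements merged into one kernel-verified Lean document; each statement's English description precedes it below -/
import Mathlib

section
/- Let u : P → [0,1] be a function on the set P of finite positions over Z = X×Y, and define f : W → [0,1] by f(w) = sup_{j∈ℕ} u(w|_j) and, for each n, f_n(w) = sup_{j≤n} u(w|_j). Then the Blackwell game Γ(f) is determined and val(Γ(f)) = lim_{n→∞} val(Γₙ(fₙ)), where Γₙ(fₙ) is the finite game of length n with payoff fₙ (which depends only on the first n moves). -/
open MeasureTheory Filter

abbrev Play (Z : Type) : Type := ℕ → Z

abbrev Strategy (Z M : Type) : Type := List Z → PMF M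

noncomputable def cylProb {X Y : Type} (σ : Strategy (X × Y) X)
    (τ : Strategy (X × Y) Y) (p : List (X × Y)) : ENNReal :=
  ∏ i : Fin p.length,
    σ (p.take i.1) (p.get i).1 * τ (p.take i.1) (p.get i).2

def cyl {Z : Type} (p : List Z) : Set (Play Z) :=
  {w | ∀ i : Fin p.length, w i.1 = p.get i}

def IsInduced {X Y : Type} [MeasurableSpace X] [MeasurableSpace Y]
    (σ : Strategy (X × Y) X) (τ : Strategy (X × Y) Y)
    (μ : Measure (Play (X × Y))) : Prop :=
  IsProbabilityMeasure μ ∧ ∀ p : List (X × Y), μ (cyl p) = cylProb σ τ p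

noncomputable def finE {X Y : Type} [Fintype X] [Fintype Y] {n : ℕ}
    (σ : Strategy (X × Y) X) (τ : Strategy (X × Y) Y)
    (f : (Fin n → X × Y) → ℝ) : ℝ :=
  ∑ p : Fin n → X × Y, (cylProb σ τ (List.ofFn p)).toReal * f p

namespace BG

variable {X Y : Type}

noncomputable def eOne [Fintype X] [Fintype Y] (a : PMF X) (b : PMF Y) (M : X × Y → ℝ) : ℝ :=
  ∑ z : X × Y, (a z.1 * b z.2).toReal * M z

lemma sum_toReal [Fintype X] (a : PMF X) : ∑ x, (a x).toReal = 1 := by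
  rw [← ENNReal.toReal_sum (fun x _ => a.apply_ne_top x), ← tsum_fintype (L := .unconditional _),
    a.tsum_coe]
  simp

lemma mem_simplex [Fintype X] (a : PMF X) : (fun x => (a x).toReal) ∈ stdSimplex ℝ X :=
  ⟨fun _ => ENNReal.toReal_nonneg, sum_toReal a⟩

lemma exists_pmf [Fintype X] {s : X → ℝ} (hs : s ∈ stdSimplex ℝ X) :
    ∃ a : PMF X, ∀ x, (a x).toReal = s x := by
  refine ⟨PMF.ofFintype (fun x => ENNReal.ofReal (s x)) ?_, fun x => ?_⟩
  · rw [← ENNReal.ofReal_sum_of_nonneg (fun x _ => hs.1 x), hs.2]; simp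
  · rw [PMF.ofFintype_apply, ENNReal.toReal_ofReal (hs.1 x)]

lemma minimax [Fintype X] [Fintype Y] [Nonempty X] [Nonempty Y] (M : X × Y → ℝ) :
    ∃ (v : ℝ) (a : PMF X) (b : PMF Y),
      (∀ b', v ≤ eOne a b' M) ∧ (∀ a', eOne a' b M ≤ v) := by
  classical
  let B : (Y → ℝ) → (X → ℝ) → ℝ := fun t s => ∑ z : X × Y, (s z.1 * t z.2) * M z
  have hne : ∀ (A : Type) [Fintype A] [Nonempty A], (stdSimplex ℝ A).Nonempty := fun A _ _ =>
    ⟨_, single_mem_stdSimplex ℝ (Classical.arbitrary A)⟩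
  have hl : ∀ s, ∃ L : (Y → ℝ) →ₗ[ℝ] ℝ, ∀ t, L t = B t s := fun s =>
    ⟨{ toFun := fun t => B t s
       map_add' := fun x y => by
         simp only [B, ← Finset.sum_add_distrib]
         exact Finset.sum_congr rfl fun z _ => by simp; ring
       map_smul' := fun c y => by
         simp only [B, smul_eq_mul, Finset.mul_sum, RingHom.id_apply]
         exact Finset.sum_congr rfl fun z _ => by simp; ring }, fun t => rfl⟩
  have hr : ∀ t, ∃ L : (X → ℝ) →ₗ[ℝ] ℝ, ∀ s, L s = B t s := fun t =>
    ⟨{ toFun := fun s => B t s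
       map_add' := fun x y => by
         simp only [B, ← Finset.sum_add_distrib]
         exact Finset.sum_congr rfl fun z _ => by simp; ring
       map_smul' := fun c y => by
         simp only [B, smul_eq_mul, Finset.mul_sum, RingHom.id_apply]
         exact Finset.sum_congr rfl fun z _ => by simp; ring }, fun t => rfl⟩
  obtain ⟨t, ht, s, hs, h⟩ := Sion.exists_isSaddlePointOn (X := stdSimplex ℝ Y)
    (Y := stdSimplex ℝ X) (f := B) (hne Y) (convex_stdSimplex ℝ Y) (isCompact_stdSimplex ℝ Y)
    (fun s _ => by
      refine Continuous.lowerSemicontinuous ?_ |>.lowerSemicontinuousOn _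
      simp only [B]; fun_prop)
    (fun s _ => by
      obtain ⟨L, hL⟩ := hl s
      have := (L.convexOn (convex_stdSimplex ℝ Y)).quasiconvexOn
      rwa [show (⇑L) = fun t => B t s from funext hL] at this)
    (convex_stdSimplex ℝ X) (hne X) (isCompact_stdSimplex ℝ X)
    (fun s _ => by
      refine Continuous.upperSemicontinuous ?_ |>.upperSemicontinuousOn _
      simp only [B]; fun_prop)
    (fun s _ => by
      obtain ⟨L, hL⟩ := hr s
      have := (L.concaveOn (convex_stdSimplex ℝ X)).quasiconcaveOn
      rwa [show (⇑L) = fun t => B s t from funext hL] at this)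
  obtain ⟨a, ha⟩ := exists_pmf hs
  obtain ⟨b, hb⟩ := exists_pmf ht
  have hB : ∀ (a : PMF X) (b : PMF Y),
      eOne a b M = B (fun y => (b y).toReal) (fun x => (a x).toReal) := by
    intro a b; simp [eOne, B]
  have ha' : (fun x => (a x).toReal) = s := funext ha
  have hb' : (fun x => (b x).toReal) = t := funext hb
  refine ⟨B t s, a, b, fun b' => ?_, fun a' => ?_⟩
  · rw [hB, ha']; exact h _ (mem_simplex b') s hs
  · rw [hB, hb']; exact h t ht _ (mem_simplex a')

section
variable [Fintype X] [Fintype Y]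

lemma eOne_mono (a : PMF X) (b : PMF Y) {M N : X × Y → ℝ} (h : ∀ z, M z ≤ N z) :
    eOne a b M ≤ eOne a b N :=
  Finset.sum_le_sum fun z _ => mul_le_mul_of_nonneg_left (h z) ENNReal.toReal_nonneg

lemma eOne_const (a : PMF X) (b : PMF Y) (c : ℝ) : eOne a b (fun _ => c) = c := by
  simp only [eOne, ENNReal.toReal_mul, ← Finset.sum_mul, Fintype.sum_prod_type]
  simp only [← Finset.mul_sum, sum_toReal, mul_one, one_mul]

lemma eOne_add (a : PMF X) (b : PMF Y) (M : X × Y → ℝ) (c : ℝ) :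
    eOne a b (fun z => M z + c) = eOne a b M + c := by
  conv_rhs => rw [← eOne_const a b c]
  simp [eOne, mul_add, Finset.sum_add_distrib]

variable [Nonempty X] [Nonempty Y]

noncomputable def val (M : X × Y → ℝ) : ℝ := (minimax M).choose
noncomputable def optA (M : X × Y → ℝ) : PMF X := (minimax M).choose_spec.choose
noncomputable def optB (M : X × Y → ℝ) : PMF Y := (minimax M).choose_spec.choose_spec.choose

lemma val_le (M : X × Y → ℝ) (b : PMF Y) : val M ≤ eOne (optA M) b M :=
  (minimax M).choose_spec.choose_spec.choose_spec.1 b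
lemma le_val (M : X × Y → ℝ) (a : PMF X) : eOne a (optB M) M ≤ val M :=
  (minimax M).choose_spec.choose_spec.choose_spec.2 a

lemma val_lip {M N : X × Y → ℝ} {c : ℝ} (h : ∀ z, M z ≤ N z + c) : val M ≤ val N + c := by
  calc val M ≤ eOne (optA M) (optB N) M := val_le _ _
    _ ≤ eOne (optA M) (optB N) (fun z => N z + c) := eOne_mono _ _ h
    _ = eOne (optA M) (optB N) N + c := eOne_add _ _ _ _
    _ ≤ _ := by gcongr; exact le_val _ _

lemma val_mono {M N : X × Y → ℝ} (h : ∀ z, M z ≤ N z) : val M ≤ val N := by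
  simpa using val_lip (c := 0) (M := M) (N := N) (by simpa using h)

lemma val_const (c : ℝ) : val (fun _ : X × Y => c) = c := by
  apply le_antisymm
  · exact (val_le (fun _ : X × Y => c) (optB fun _ : X × Y => c)).trans (eOne_const _ _ _).le
  · exact (eOne_const _ _ _).ge.trans (le_val (fun _ : X × Y => c) (optA fun _ : X × Y => c))

noncomputable def U (F : List (X × Y) → ℝ) : ℕ → List (X × Y) → ℝ
  | 0, p => F p
  | n + 1, p => val fun z => U F n (p ++ [z])

variable {F : List (X × Y) → ℝ}

lemma U_mono (hF : ∀ p z, F p ≤ F (p ++ [z])) (p : List (X × Y)) : Monotone fun n => U F n p := by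
  refine monotone_nat_of_le_succ fun n => ?_
  induction n generalizing p with
  | zero => exact (val_const (F p)).ge.trans (val_mono fun z => hF p z)
  | succ n ih => exact val_mono fun z => ih (p ++ [z])

lemma U_mem (hF : ∀ p, F p ∈ Set.Icc (0 : ℝ) 1) (n : ℕ) (p : List (X × Y)) :
    U F n p ∈ Set.Icc (0 : ℝ) 1 := by
  induction n generalizing p with
  | zero => exact hF p
  | succ n ih =>
    exact ⟨(val_const (X := X) (Y := Y) 0).ge.trans (val_mono fun z => (ih _).1),
      (val_mono fun z => (ih _).2).trans (val_const (X := X) (Y := Y) 1).le⟩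

noncomputable def Ui (F : List (X × Y) → ℝ) (p : List (X × Y)) : ℝ := ⨆ n, U F n p

lemma U_bdd (hF : ∀ p, F p ∈ Set.Icc (0 : ℝ) 1) (p : List (X × Y)) :
    BddAbove (Set.range fun n => U F n p) :=
  ⟨1, by rintro _ ⟨n, rfl⟩; exact (U_mem hF n p).2⟩

lemma U_tendsto (hF : ∀ p, F p ∈ Set.Icc (0 : ℝ) 1) (hF' : ∀ p z, F p ≤ F (p ++ [z]))
    (p : List (X × Y)) : Tendsto (fun n => U F n p) atTop (nhds (Ui F p)) :=
  tendsto_atTop_ciSup (U_mono hF' p) (U_bdd hF p)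

lemma val_Ui (hF : ∀ p, F p ∈ Set.Icc (0 : ℝ) 1) (hF' : ∀ p z, F p ≤ F (p ++ [z]))
    (p : List (X × Y)) : val (fun z => Ui F (p ++ [z])) ≤ Ui F p := by
  refine le_of_forall_pos_le_add fun ε hε => ?_
  have h : ∀ᶠ n in atTop, ∀ z, Ui F (p ++ [z]) ≤ U F n (p ++ [z]) + ε := by
    rw [eventually_all]
    intro z
    have := (U_tendsto hF hF' (p ++ [z])).eventually (lt_mem_nhds (sub_lt_self _ hε))
    exact this.mono fun n hn => by linarith
  obtain ⟨n, hn⟩ := h.exists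
  refine (val_lip hn).trans ?_
  gcongr
  exact le_ciSup (U_bdd hF p) (n + 1)

end

lemma cylProb_append (σ : Strategy (X × Y) X) (τ : Strategy (X × Y) Y) (p : List (X × Y))
    (z : X × Y) : cylProb σ τ (p ++ [z]) = cylProb σ τ p * (σ p z.1 * τ p z.2) := by
  have h : (p ++ [z]).length = p.length + 1 := by simp
  unfold cylProb
  rw [← (finCongr h.symm).prod_comp, Fin.prod_univ_castSucc]
  congr 1
  · refine Finset.prod_congr rfl fun i _ => ?_
    have h1 : (p ++ [z]).take i.1 = p.take i.1 := List.take_append_of_le_length i.2.le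
    simp [h1]
  · simp

section
variable [Fintype X] [Fintype Y]

noncomputable def E (σ : Strategy (X × Y) X) (τ : Strategy (X × Y) Y) (k : ℕ)
    (g : List (X × Y) → ℝ) : ℝ := finE σ τ (fun p : Fin k → X × Y => g (List.ofFn p))

lemma E_zero (σ : Strategy (X × Y) X) (τ : Strategy (X × Y) Y) (g : List (X × Y) → ℝ) :
    E σ τ 0 g = g [] := by
  have h : cylProb σ τ [] = 1 := Finset.prod_empty
  simp [E, finE, h]

lemma E_succ (σ : Strategy (X × Y) X) (τ : Strategy (X × Y) Y) (k : ℕ) (g : List (X × Y) → ℝ) :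
    E σ τ (k + 1) g = E σ τ k (fun p => eOne (σ p) (τ p) fun z => g (p ++ [z])) := by
  unfold E finE
  rw [← (Fin.snocEquiv (fun _ : Fin (k + 1) => X × Y)).sum_comp, Fintype.sum_prod_type_right]
  refine Finset.sum_congr rfl fun p _ => ?_
  simp only [eOne, Finset.mul_sum]
  refine Finset.sum_congr rfl fun z _ => ?_
  have : List.ofFn (Fin.snocEquiv (fun _ : Fin (k + 1) => X × Y) (z, p)) = List.ofFn p ++ [z] := by
    rw [List.ofFn_succ']; simp [Fin.snocEquiv]
  rw [this, cylProb_append, ENNReal.toReal_mul, mul_assoc]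

lemma E_mono (σ : Strategy (X × Y) X) (τ : Strategy (X × Y) Y) (k : ℕ) {g h : List (X × Y) → ℝ}
    (H : ∀ p, p.length = k → g p ≤ h p) : E σ τ k g ≤ E σ τ k h :=
  Finset.sum_le_sum fun p _ => mul_le_mul_of_nonneg_left (H _ (by simp)) ENNReal.toReal_nonneg

lemma E_const (σ : Strategy (X × Y) X) (τ : Strategy (X × Y) Y) (k : ℕ) (c : ℝ) :
    E σ τ k (fun _ => c) = c := by
  induction k with
  | zero => rw [E_zero]
  | succ k ih => rw [E_succ]; simpa only [eOne_const] using ih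

variable [Nonempty X] [Nonempty Y] {F : List (X × Y) → ℝ}

lemma lower (F : List (X × Y) → ℝ) (n : ℕ) :
    ∃ σ : Strategy (X × Y) X, ∀ τ, U F n [] ≤ E σ τ n F := by
  refine ⟨fun p => optA fun z => U F (n - p.length - 1) (p ++ [z]), fun τ => ?_⟩
  set σ : Strategy (X × Y) X := fun p => optA fun z => U F (n - p.length - 1) (p ++ [z]) with hσ
  have key : ∀ k ≤ n, U F n [] ≤ E σ τ k (U F (n - k)) := by
    intro k
    induction k with
    | zero => intro _; rw [E_zero]; simp
    | succ k ih =>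
      intro hk
      refine (ih (by omega)).trans ?_
      rw [E_succ]
      refine E_mono _ _ _ fun p hp => ?_
      have h1 : n - k = (n - (k + 1)) + 1 := by omega
      have h2 : n - p.length - 1 = n - (k + 1) := by omega
      rw [h1, hσ]
      simp only [h2]
      exact val_le _ _
  have := key n le_rfl
  rw [Nat.sub_self] at this
  exact this

lemma upper (hF : ∀ p, F p ∈ Set.Icc (0 : ℝ) 1) (hF' : ∀ p z, F p ≤ F (p ++ [z])) :
    ∃ τ : Strategy (X × Y) Y, ∀ σ n, E σ τ n F ≤ Ui F [] := by
  refine ⟨fun p => optB fun z => Ui F (p ++ [z]), fun σ n => ?_⟩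
  refine (E_mono _ _ _ (h := Ui F) fun p _ => le_ciSup (U_bdd hF p) 0).trans ?_
  induction n with
  | zero => rw [E_zero]
  | succ n ih =>
    rw [E_succ]
    exact (E_mono _ _ _ fun p _ => (le_val _ _).trans (val_Ui hF hF' p)).trans ih

end

section Meas
variable [Fintype X] [Fintype Y] [MeasurableSpace X] [MeasurableSpace Y]

lemma singletons
    (μ : Strategy (X × Y) X → Strategy (X × Y) Y → Measure (Play (X × Y)))
    (hμ : ∀ σ τ, IsInduced σ τ (μ σ τ)) : MeasurableSingletonClass (X × Y) := by
  classical
  refine ⟨fun z => ?_⟩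
  have hat := MeasurableSet.measurableAtom_of_countable z
  suffices h : measurableAtom z = {z} by rwa [h] at hat
  refine Set.Subset.antisymm (fun z' hz' => ?_) (by simp)
  by_contra hne
  have hne : z' ≠ z := hne
  have hsym : z ∈ measurableAtom z' := by
    rw [measurableAtom_eq_of_mem hz']; exact mem_measurableAtom_self z
  let σ : Strategy (X × Y) X := fun _ => PMF.pure z.1
  let τ : Strategy (X × Y) Y := fun _ => PMF.pure z.2
  have h1 : μ σ τ (cyl [z]) = 1 := by
    rw [(hμ σ τ).2]; simp [cylProb, σ, τ]
  have h0 : μ σ τ (cyl [z']) = 0 := by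
    rw [(hμ σ τ).2]
    have : z'.1 ≠ z.1 ∨ z'.2 ≠ z.2 := by
      by_contra hc
      push Not at hc
      exact hne (Prod.ext hc.1 hc.2)
    simp only [cylProb, σ, τ, PMF.pure_apply]
    rcases this with h | h <;> simp [h]
  obtain ⟨N, hsub, hN, hN0⟩ := exists_measurable_superset_of_null h0
  let φ : Play (X × Y) → Play (X × Y) := fun w i => Equiv.swap z z' (w i)
  have hswap : ∀ s : Set (X × Y), MeasurableSet s → ∀ a, Equiv.swap z z' a ∈ s ↔ a ∈ s := by
    intro s hs a
    have hzz : z ∈ s ↔ z' ∈ s :=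
      ⟨fun h => mem_of_mem_measurableAtom hz' hs h, fun h => mem_of_mem_measurableAtom hsym hs h⟩
    by_cases ha : a = z
    · subst ha; simp [hzz]
    by_cases hb : a = z'
    · subst hb; simp [hzz]
    rw [Equiv.swap_apply_of_ne_of_ne ha hb]
  have hle : (inferInstance : MeasurableSpace (Play (X × Y))) ≤ MeasurableSpace.invariants φ := by
    refine iSup_le fun i => ?_
    rintro _ ⟨s, hs, rfl⟩
    rw [MeasurableSpace.measurableSet_invariants]
    refine ⟨measurable_pi_apply i hs, ?_⟩
    ext w
    exact hswap s hs (w i)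
  have hinv := (MeasurableSpace.measurableSet_invariants.1 (hle N hN)).2
  have : cyl [z] ⊆ N := by
    intro w hw
    have hw0 : w 0 = z := hw ⟨0, by simp⟩
    rw [← hinv]
    apply hsub
    rintro ⟨i, hi⟩
    simp at hi
    subst hi
    simp [φ, hw0]
  have := measure_mono_null this hN0
  rw [h1] at this
  exact one_ne_zero this

lemma integral_eq [MeasurableSingletonClass (X × Y)] {σ : Strategy (X × Y) X}
    {τ : Strategy (X × Y) Y} {μ : Measure (Play (X × Y))} (h : IsInduced σ τ μ)
    (g : List (X × Y) → ℝ) (n : ℕ) :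
    Measurable (fun w : Play (X × Y) => g (List.ofFn fun i : Fin n => w i.1)) ∧
    ∫ w, g (List.ofFn fun i : Fin n => w i.1) ∂μ = E σ τ n g := by
  have := h.1
  let r : Play (X × Y) → (Fin n → X × Y) := fun w i => w i.1
  have hr : Measurable r := measurable_pi_lambda _ fun i => measurable_pi_apply _
  let G : (Fin n → X × Y) → ℝ := fun p => g (List.ofFn p)
  have hG : Measurable G := measurable_of_finite G
  refine ⟨hG.comp hr, ?_⟩
  have hp : IsProbabilityMeasure (μ.map r) := Measure.isProbabilityMeasure_map hr.aemeasurable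
  change ∫ w, G (r w) ∂μ = _
  rw [← integral_map hr.aemeasurable hG.aestronglyMeasurable, integral_fintype .of_finite]
  refine Finset.sum_congr rfl fun p _ => ?_
  rw [smul_eq_mul, ← h.2, Measure.real, Measure.map_apply hr (measurableSet_singleton p)]
  congr 3
  ext w
  simp only [Set.mem_preimage, Set.mem_singleton_iff, cyl, Set.mem_ofPred_eq, r]
  constructor
  · rintro rfl i; simp
  · intro hw
    funext i
    simpa using hw ⟨i.1, by simp⟩

end Meas

end BG

open BG in
/-- Determinacy of generalized open games: if the payoff is the supremum of a
bounded function of positions along the play, the game is determined and its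
value is the limit of the values of the finite truncations. -/
theorem stmt_13 {X Y : Type} [Fintype X] [Nonempty X] [Fintype Y] [Nonempty Y]
    [MeasurableSpace X] [MeasurableSpace Y]
    (μ : Strategy (X × Y) X → Strategy (X × Y) Y → Measure (Play (X × Y)))
    (hμ : ∀ σ τ, IsInduced σ τ (μ σ τ))
    (u : List (X × Y) → ℝ) (hu : ∀ p, u p ∈ Set.Icc (0 : ℝ) 1)
    (f : Play (X × Y) → ℝ)
    (hf : ∀ w, f w = ⨆ j : ℕ, u (List.ofFn fun i : Fin j => w i.1))
    (fn : (n : ℕ) → (Fin n → X × Y) → ℝ)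
    (hfn : ∀ n p, fn n p = ⨆ j : Fin (n + 1), u ((List.ofFn p).take j.1)) :
    ∃ v : ℝ,
      Tendsto
        (fun n => ⨆ σ : Strategy (X × Y) X, ⨅ τ : Strategy (X × Y) Y,
          finE σ τ (fn n)) atTop (nhds v) ∧
      (⨆ σ : Strategy (X × Y) X, ⨅ τ : Strategy (X × Y) Y,
        ∫ w, f w ∂(μ σ τ)) = v ∧
      (⨅ τ : Strategy (X × Y) Y, ⨆ σ : Strategy (X × Y) X,
        ∫ w, f w ∂(μ σ τ)) = v := by
  have hms := singletons μ hμ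
  let F : List (X × Y) → ℝ := fun p => ⨆ j : Fin (p.length + 1), u (p.take j.1)
  have hbd : ∀ p : List (X × Y), BddAbove (Set.range fun j : Fin (p.length + 1) => u (p.take j.1)) :=
    fun p => Set.finite_range _ |>.bddAbove
  have huF : ∀ (p : List (X × Y)) (j : ℕ), u (p.take j) ≤ F p := by
    intro p j
    have : p.take j = p.take (min j p.length) := by simp
    rw [this]
    exact le_ciSup (hbd p) ⟨min j p.length, by omega⟩
  have hF : ∀ p, F p ∈ Set.Icc (0 : ℝ) 1 := fun p =>
    ⟨(hu _).1.trans (huF p 0), ciSup_le fun j => (hu _).2⟩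
  have hF' : ∀ p z, F p ≤ F (p ++ [z]) := by
    intro p z
    refine ciSup_le fun j => ?_
    have : p.take j.1 = (p ++ [z]).take j.1 :=
      (List.take_append_of_le_length (by omega)).symm
    rw [this]
    exact huF _ _
  have hfE : ∀ σ τ n, finE σ τ (fn n) = E σ τ n F := by
    intro σ τ n
    have : fn n = fun p => F (List.ofFn p) := by
      funext p
      rw [hfn]
      have hl : (List.ofFn p).length + 1 = n + 1 := by simp
      exact (finCongr hl).symm.iSup_congr fun j => by simp
    rw [this]; rfl
  have hE : ∀ σ τ n, E σ τ n F ∈ Set.Icc (0 : ℝ) 1 := fun σ τ n =>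
    ⟨(E_const σ τ n 0).ge.trans (E_mono _ _ _ fun p _ => (hF p).1),
      (E_mono _ _ _ fun p _ => (hF p).2).trans (E_const σ τ n 1).le⟩
  -- the truncations converge pointwise to `f`
  let fw : ℕ → Play (X × Y) → ℝ := fun n w => F (List.ofFn fun i : Fin n => w i.1)
  have hfwm : ∀ w, Monotone fun n => fw n w := fun w =>
    monotone_nat_of_le_succ fun n => by
      simp only [fw]
      rw [List.ofFn_succ' (fun i : Fin (n + 1) => w i.1), List.concat_eq_append]
      exact hF' _ _
  have hub : ∀ w : Play (X × Y),
      BddAbove (Set.range fun j : ℕ => u (List.ofFn fun i : Fin j => w i.1)) := fun w =>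
    ⟨1, by rintro _ ⟨j, rfl⟩; exact (hu _).2⟩
  have hfwb : ∀ w : Play (X × Y), BddAbove (Set.range fun n => fw n w) := fun w =>
    ⟨1, by rintro _ ⟨j, rfl⟩; exact (hF _).2⟩
  have htake : ∀ (w : Play (X × Y)) (n j : ℕ), j ≤ n →
      (List.ofFn fun i : Fin n => w i.1).take j = List.ofFn fun i : Fin j => w i.1 := by
    intro w n j hj
    apply List.ext_getElem
    · simp [hj]
    · intro i h1 h2; simp
  have hfs : ∀ w, f w = ⨆ n, fw n w := by
    intro w
    rw [hf]
    apply le_antisymm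
    · refine ciSup_le fun j => ?_
      refine le_trans ?_ (le_ciSup (hfwb w) j)
      have := huF (List.ofFn fun i : Fin j => w i.1) j
      rwa [htake w j j le_rfl] at this
    · refine ciSup_le fun n => ciSup_le fun j => ?_
      have hj : j.1 ≤ n := by have := j.2; simp at this; omega
      rw [htake w n j.1 hj]
      exact le_ciSup (hub w) j.1
  have hlim : ∀ w, Tendsto (fun n => fw n w) atTop (nhds (f w)) := fun w => by
    rw [hfs]; exact tendsto_atTop_ciSup (hfwm w) (hfwb w)
  have hEt : ∀ σ τ, Tendsto (fun n => E σ τ n F) atTop (nhds (∫ w, f w ∂(μ σ τ))) := by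
    intro σ τ
    have := (hμ σ τ).1
    have h := tendsto_integral_of_dominated_convergence (μ := μ σ τ) (F := fw) (f := f)
      (fun _ => 1) (fun n => (integral_eq (hμ σ τ) F n).1.aestronglyMeasurable)
      (integrable_const _)
      (fun n => ae_of_all _ fun w => by
        rw [Real.norm_eq_abs, abs_of_nonneg (hF _).1]; exact (hF _).2)
      (ae_of_all _ hlim)
    exact h.congr fun n => (integral_eq (hμ σ τ) F n).2
  have hEm : ∀ σ τ, Monotone fun n => E σ τ n F := fun σ τ =>
    monotone_nat_of_le_succ fun n => by
      rw [E_succ]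
      refine E_mono _ _ _ fun p _ => ?_
      exact (eOne_const _ _ _).ge.trans (eOne_mono _ _ fun z => hF' p z)
  have hI : ∀ σ τ n, E σ τ n F ≤ ∫ w, f w ∂(μ σ τ) := fun σ τ n => (hEm σ τ).ge_of_tendsto (hEt σ τ) n
  have hI01 : ∀ σ τ, ∫ w, f w ∂(μ σ τ) ∈ Set.Icc (0 : ℝ) 1 := fun σ τ =>
    ⟨(hE σ τ 0).1.trans (hI σ τ 0), le_of_tendsto' (hEt σ τ) fun n => (hE σ τ n).2⟩
  have hnX : Nonempty (Strategy (X × Y) X) := ⟨fun _ => PMF.pure (Classical.arbitrary X)⟩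
  have hnY : Nonempty (Strategy (X × Y) Y) := ⟨fun _ => PMF.pure (Classical.arbitrary Y)⟩
  -- generic bounds for sup-inf
  have gen : ∀ (g : Strategy (X × Y) X → Strategy (X × Y) Y → ℝ),
      (∀ σ τ, g σ τ ∈ Set.Icc (0 : ℝ) 1) → ∀ c : ℝ,
      ((∃ σ, ∀ τ, c ≤ g σ τ) → c ≤ ⨆ σ, ⨅ τ, g σ τ) ∧
      ((∃ τ, ∀ σ, g σ τ ≤ c) → (⨅ τ, ⨆ σ, g σ τ) ≤ c) ∧
      (⨆ σ, ⨅ τ, g σ τ) ≤ ⨅ τ, ⨆ σ, g σ τ := by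
    intro g hg c
    have b1 : ∀ σ, BddBelow (Set.range fun τ => g σ τ) := fun σ =>
      ⟨0, by rintro _ ⟨τ, rfl⟩; exact (hg σ τ).1⟩
    have b2 : ∀ τ, BddAbove (Set.range fun σ => g σ τ) := fun τ =>
      ⟨1, by rintro _ ⟨σ, rfl⟩; exact (hg σ τ).2⟩
    have b3 : BddAbove (Set.range fun σ => ⨅ τ, g σ τ) :=
      ⟨1, by rintro _ ⟨σ, rfl⟩; exact (ciInf_le (b1 σ) hnY.some).trans (hg _ _).2⟩
    have b4 : BddBelow (Set.range fun τ => ⨆ σ, g σ τ) :=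
      ⟨0, by rintro _ ⟨τ, rfl⟩; exact (hg _ _).1.trans (le_ciSup (b2 τ) hnX.some)⟩
    refine ⟨?_, ?_, ?_⟩
    · rintro ⟨σ, h⟩
      exact (le_ciInf h).trans (le_ciSup b3 σ)
    · rintro ⟨τ, h⟩
      exact (ciInf_le b4 τ).trans (ciSup_le h)
    · exact ciSup_le fun σ => le_ciInf fun τ => (ciInf_le (b1 σ) τ).trans (le_ciSup (b2 τ) σ)
  obtain ⟨τ', hτ'⟩ := upper hF hF'
  have gI := gen (fun σ τ => ∫ w, f w ∂(μ σ τ)) hI01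
  have hup : (⨅ τ : Strategy (X × Y) Y, ⨆ σ : Strategy (X × Y) X, ∫ w, f w ∂(μ σ τ)) ≤ Ui F [] :=
    (gI _).2.1 ⟨τ', fun σ => le_of_tendsto' (hEt σ τ') fun n => hτ' σ n⟩
  have hlo : Ui F [] ≤ ⨆ σ : Strategy (X × Y) X, ⨅ τ : Strategy (X × Y) Y, ∫ w, f w ∂(μ σ τ) :=
    ciSup_le fun n => (gI _).1 <| by
      obtain ⟨σ, hσ⟩ := lower F n
      exact ⟨σ, fun τ => (hσ τ).trans (hI σ τ n)⟩
  have hmid := (gI 0).2.2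
  refine ⟨Ui F [], ?_, le_antisymm (hmid.trans hup) hlo, le_antisymm hup (hlo.trans hmid)⟩
  simp only [hfE]
  refine tendsto_of_tendsto_of_tendsto_of_le_of_le (U_tendsto hF hF' []) tendsto_const_nhds
    (fun n => ?_) (fun n => ?_)
  · exact (gen (fun σ τ => E σ τ n F) (fun σ τ => hE σ τ n) _).1 (lower F n)
  · have g := gen (fun σ τ => E σ τ n F) (fun σ τ => hE σ τ n) (Ui F [])
    exact g.2.2.trans (g.2.1 ⟨τ', fun σ => hτ' σ n⟩)
end

section
/- Let D ⊆ W be a Gδ set. Then the Blackwell game Γ(D) is determined and val(Γ(D)) = inf over open O ⊇ D of val(Γ(O)). -/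
open MeasureTheory Filter

namespace BW

section Matrix
variable {X Y : Type} [Fintype X] [Nonempty X] [Fintype Y] [Nonempty Y]

/-- Turn a point of the simplex into a PMF. -/
lemma exists_pmf {A : Type} [Fintype A] (a : A → ℝ) (ha : a ∈ stdSimplex ℝ A) :
    ∃ p : PMF A, ∀ x, (p x).toReal = a x := by
  refine ⟨PMF.ofFintype (fun x => ENNReal.ofReal (a x)) ?_, ?_⟩
  · rw [← ENNReal.ofReal_sum_of_nonneg (fun i _ => ha.1 i), ha.2, ENNReal.ofReal_one]
  · intro x
    rw [PMF.ofFintype_apply, ENNReal.toReal_ofReal (ha.1 x)]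

lemma pmf_sum {A : Type} [Fintype A] (p : PMF A) : ∑ x, (p x).toReal = 1 := by
  rw [← ENNReal.toReal_sum (fun x _ => p.apply_ne_top x)]
  have := p.tsum_coe
  rw [tsum_fintype] at this
  simp [this]

lemma minimax_exists (M : X × Y → ℝ) : ∃ c : ℝ, ∃ a : PMF X, ∃ b : PMF Y,
    (∀ y, c ≤ ∑ x, (a x).toReal * M (x, y)) ∧ (∀ x, ∑ y, (b y).toReal * M (x, y) ≤ c) := by
  classical
  let f : (Y → ℝ) → (X → ℝ) → ℝ := fun b a => ∑ x, ∑ y, a x * b y * M (x, y)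
  have hfl : ∀ a : X → ℝ, IsLinearMap ℝ (fun b => f b a) := by
    intro a
    constructor
    · intro u v
      simp only [f, Pi.add_apply, ← Finset.sum_add_distrib]
      refine Finset.sum_congr rfl fun x _ => Finset.sum_congr rfl fun y _ => by ring
    · intro c u
      simp only [f, Pi.smul_apply, smul_eq_mul, Finset.mul_sum]
      refine Finset.sum_congr rfl fun x _ => Finset.sum_congr rfl fun y _ => by ring
  have hfr : ∀ b : Y → ℝ, IsLinearMap ℝ (fun a => f b a) := by
    intro a
    constructor
    · intro u v
      simp only [f, Pi.add_apply, ← Finset.sum_add_distrib]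
      refine Finset.sum_congr rfl fun x _ => Finset.sum_congr rfl fun y _ => by ring
    · intro c u
      simp only [f, Pi.smul_apply, smul_eq_mul, Finset.mul_sum]
      refine Finset.sum_congr rfl fun x _ => Finset.sum_congr rfl fun y _ => by ring
  have nY : (stdSimplex ℝ Y).Nonempty :=
    ⟨Pi.single (Classical.arbitrary Y) 1, single_mem_stdSimplex ℝ _⟩
  have nX : (stdSimplex ℝ X).Nonempty :=
    ⟨Pi.single (Classical.arbitrary X) 1, single_mem_stdSimplex ℝ _⟩
  obtain ⟨b, hb, a, ha, h⟩ := Sion.exists_isSaddlePointOn' (X := stdSimplex ℝ Y)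
    (Y := stdSimplex ℝ X) (f := f) nY (isCompact_stdSimplex ℝ Y)
    (fun a _ => Continuous.lowerSemicontinuous (by fun_prop) |>.lowerSemicontinuousOn _)
    (fun a _ => (((hfl a).mk' _).convexOn (convex_stdSimplex ℝ Y)).quasiconvexOn)
    (convex_stdSimplex ℝ X) (isCompact_stdSimplex ℝ X)
    (fun b _ => Continuous.upperSemicontinuous (by fun_prop) |>.upperSemicontinuousOn _)
    (fun b _ => (((hfr b).mk' _).concaveOn (convex_stdSimplex ℝ X)).quasiconcaveOn)
    (convex_stdSimplex ℝ Y) nX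
  obtain ⟨pa, hpa⟩ := exists_pmf a ha
  obtain ⟨pb, hpb⟩ := exists_pmf b hb
  refine ⟨f b a, pa, pb, ?_, ?_⟩
  · intro y
    have := h (Pi.single y 1) (single_mem_stdSimplex ℝ y) a ha
    refine this.trans (le_of_eq ?_)
    simp only [f, hpa]
    refine Finset.sum_congr rfl fun x _ => ?_
    rw [Finset.sum_eq_single y] <;> simp +contextual
  · intro x
    have := h b hb (Pi.single x 1) (single_mem_stdSimplex ℝ x)
    refine le_trans (le_of_eq ?_) this
    simp only [f, hpb]
    rw [Finset.sum_eq_single x] <;> simp +contextual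

/-- Value of a matrix game. -/
noncomputable def mval (M : X × Y → ℝ) : ℝ := (minimax_exists M).choose

noncomputable def optX (M : X × Y → ℝ) : PMF X := (minimax_exists M).choose_spec.choose

noncomputable def optY (M : X × Y → ℝ) : PMF Y :=
  (minimax_exists M).choose_spec.choose_spec.choose

/-- One-step expectation. -/
noncomputable def ev (a : PMF X) (b : PMF Y) (M : X × Y → ℝ) : ℝ :=
  ∑ z : X × Y, (a z.1).toReal * (b z.2).toReal * M z

lemma mval_le_ev (M : X × Y → ℝ) (b : PMF Y) : mval M ≤ ev (optX M) b M := by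
  have h : ∀ y, mval M ≤ ∑ x, (optX M x).toReal * M (x, y) :=
    (minimax_exists M).choose_spec.choose_spec.choose_spec.1
  calc mval M = ∑ y, (b y).toReal * mval M := by rw [← Finset.sum_mul, pmf_sum, one_mul]
    _ ≤ ∑ y, (b y).toReal * ∑ x, (optX M x).toReal * M (x, y) :=
        Finset.sum_le_sum fun y _ => mul_le_mul_of_nonneg_left (h y) ENNReal.toReal_nonneg
    _ = ev (optX M) b M := by
        unfold ev
        rw [Fintype.sum_prod_type, Finset.sum_comm]
        refine Finset.sum_congr rfl fun y _ => ?_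
        rw [Finset.mul_sum]
        refine Finset.sum_congr rfl fun x _ => by ring

lemma ev_le_mval (M : X × Y → ℝ) (a : PMF X) : ev a (optY M) M ≤ mval M := by
  have h : ∀ x, ∑ y, (optY M y).toReal * M (x, y) ≤ mval M :=
    (minimax_exists M).choose_spec.choose_spec.choose_spec.2
  calc ev a (optY M) M = ∑ x, (a x).toReal * ∑ y, (optY M y).toReal * M (x, y) := by
        unfold ev
        rw [Fintype.sum_prod_type]
        refine Finset.sum_congr rfl fun y _ => ?_
        rw [Finset.mul_sum]
        refine Finset.sum_congr rfl fun x _ => by ring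
    _ ≤ ∑ x, (a x).toReal * mval M :=
        Finset.sum_le_sum fun y _ => mul_le_mul_of_nonneg_left (h y) ENNReal.toReal_nonneg
    _ = mval M := by rw [← Finset.sum_mul, pmf_sum, one_mul]

lemma ev_mono (a : PMF X) (b : PMF Y) {M M' : X × Y → ℝ} (h : ∀ z, M z ≤ M' z) :
    ev a b M ≤ ev a b M' :=
  Finset.sum_le_sum fun z _ => mul_le_mul_of_nonneg_left (h z) (by positivity)

lemma ev_add (a : PMF X) (b : PMF Y) (M : X × Y → ℝ) (d : ℝ) :
    ev a b (fun z => M z + d) = ev a b M + d := by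
  have : ∑ z : X × Y, (a z.1).toReal * (b z.2).toReal = 1 := by
    rw [Fintype.sum_prod_type]
    simp only [← Finset.mul_sum, pmf_sum, mul_one]
  unfold ev
  simp only [mul_add, Finset.sum_add_distrib]
  rw [← Finset.sum_mul, this, one_mul]

lemma ev_const (a : PMF X) (b : PMF Y) (d : ℝ) : ev a b (fun _ => d) = d := by
  have := ev_add a b (fun _ => 0) d
  simpa [ev] using this

lemma mval_le {M M' : X × Y → ℝ} {d : ℝ} (h : ∀ z, M z ≤ M' z + d) :
    mval M ≤ mval M' + d :=
  calc mval M ≤ ev (optX M) (optY M') M := mval_le_ev _ _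
    _ ≤ ev (optX M) (optY M') (fun z => M' z + d) := ev_mono _ _ h
    _ = ev (optX M) (optY M') M' + d := ev_add _ _ _ _
    _ ≤ mval M' + d := by linarith [ev_le_mval M' (optX M)]

lemma mval_const (d : ℝ) : mval (fun _ : X × Y => d) = d := by
  apply le_antisymm
  · have := mval_le_ev (fun _ : X × Y => d) (optY (fun _ : X × Y => d))
    rwa [ev_const] at this
  · have := ev_le_mval (fun _ : X × Y => d) (optX (fun _ : X × Y => d))
    rwa [ev_const] at this

end Matrix

section Value
variable {X Y : Type} [Fintype X] [Nonempty X] [Fintype Y] [Nonempty Y]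

/-- `V` is a superharmonic certificate, at position `p`, bounding the value of `D` from above. -/
def IsCert (D : Set (Play (X × Y))) (p : List (X × Y)) (V : List (X × Y) → ℝ)
    (S : Set (List (X × Y))) : Prop :=
  (∀ q, 0 ≤ V q) ∧ (∀ q, mval (fun z => V (q ++ [z])) ≤ V q) ∧
  (∀ q ∈ S, ∀ z, q ++ [z] ∈ S) ∧ (∀ q ∈ S, 1 ≤ V q) ∧
  (∀ w ∈ D, w ∈ cyl p → ∃ q ∈ S, w ∈ cyl (p ++ q))

def certVals (D : Set (Play (X × Y))) (p : List (X × Y)) : Set ℝ :=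
  {c | ∃ V S, IsCert D p V S ∧ V [] = c}

noncomputable def vv (D : Set (Play (X × Y))) (p : List (X × Y)) : ℝ := sInf (certVals D p)

lemma one_mem_certVals (D : Set (Play (X × Y))) (p : List (X × Y)) : 1 ∈ certVals D p := by
  refine ⟨fun _ => 1, Set.univ, ⟨fun _ => zero_le_one, fun q => ?_, fun _ _ _ => trivial,
    fun _ _ => le_rfl, fun w _ hw => ⟨[], trivial, ?_⟩⟩, rfl⟩
  · rw [mval_const]
  · simpa using hw

lemma certVals_bdd (D : Set (Play (X × Y))) (p : List (X × Y)) : BddBelow (certVals D p) := by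
  refine ⟨0, ?_⟩
  rintro c ⟨V, S, h, rfl⟩
  exact h.1 _

lemma vv_nonneg (D : Set (Play (X × Y))) (p : List (X × Y)) : 0 ≤ vv D p := by
  refine le_csInf ⟨1, one_mem_certVals D p⟩ ?_
  rintro c ⟨V, S, h, rfl⟩
  exact h.1 _

lemma vv_le_one (D : Set (Play (X × Y))) (p : List (X × Y)) : vv D p ≤ 1 :=
  csInf_le (certVals_bdd D p) (one_mem_certVals D p)

open Classical in
/-- Horizon-`N` value of the game of reaching `G` strictly later, with reward `v` there. -/
noncomputable def reach (v : List (X × Y) → ℝ) (G : Set (List (X × Y))) :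
    ℕ → List (X × Y) → ℝ
  | 0, _ => 0
  | N + 1, p => mval (fun z => if p ++ [z] ∈ G then v (p ++ [z]) else reach v G N (p ++ [z]))

open Classical in
lemma reach_nonneg {v : List (X × Y) → ℝ} (G : Set (List (X × Y))) (hv : ∀ p, 0 ≤ v p) :
    ∀ N p, 0 ≤ reach v G N p
  | 0, _ => le_rfl
  | N + 1, p => by
      rw [reach]
      have := mval_le (X := X) (Y := Y) (d := 0) (M := fun _ => 0)
        (M' := fun z => if p ++ [z] ∈ G then v (p ++ [z]) else reach v G N (p ++ [z])) (by
          intro z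
          have := reach_nonneg G hv N (p ++ [z])
          have := hv (p ++ [z])
          split_ifs <;> linarith)
      rw [mval_const] at this
      linarith

open Classical in
lemma reach_le_one {v : List (X × Y) → ℝ} (G : Set (List (X × Y))) (hv : ∀ p, v p ≤ 1) :
    ∀ N p, reach v G N p ≤ 1
  | 0, _ => zero_le_one
  | N + 1, p => by
      rw [reach]
      have := mval_le (X := X) (Y := Y) (d := 0) (M' := fun _ => 1)
        (M := fun z => if p ++ [z] ∈ G then v (p ++ [z]) else reach v G N (p ++ [z])) (by
          intro z
          have := reach_le_one G hv N (p ++ [z])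
          have := hv (p ++ [z])
          split_ifs <;> linarith)
      rw [mval_const] at this
      linarith

open Classical in
lemma reach_step {v : List (X × Y) → ℝ} (G : Set (List (X × Y))) (hv : ∀ p, 0 ≤ v p) :
    ∀ N p, reach v G N p ≤ reach v G (N + 1) p
  | 0, p => reach_nonneg G hv _ p
  | N + 1, p => by
      rw [reach, reach]
      have := mval_le (X := X) (Y := Y) (d := 0)
        (M' := fun z => if p ++ [z] ∈ G then v (p ++ [z]) else reach v G (N + 1) (p ++ [z]))
        (M := fun z => if p ++ [z] ∈ G then v (p ++ [z]) else reach v G N (p ++ [z])) (by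
          intro z
          have := reach_step G hv N (p ++ [z])
          split_ifs <;> linarith)
      linarith

lemma reach_mono {v : List (X × Y) → ℝ} (G : Set (List (X × Y))) (hv : ∀ p, 0 ≤ v p)
    (p : List (X × Y)) : Monotone (fun N => reach v G N p) :=
  monotone_nat_of_le_succ fun N => reach_step G hv N p

noncomputable def areach (v : List (X × Y) → ℝ) (G : Set (List (X × Y)))
    (p : List (X × Y)) : ℝ := ⨆ N, reach v G N p

lemma areach_bdd {v : List (X × Y) → ℝ} (G : Set (List (X × Y))) (hv1 : ∀ p, v p ≤ 1)
    (p : List (X × Y)) : BddAbove (Set.range fun N => reach v G N p) := by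
  refine ⟨1, ?_⟩
  rintro _ ⟨N, rfl⟩
  exact reach_le_one G hv1 N p

lemma areach_approx {v : List (X × Y) → ℝ} (G : Set (List (X × Y)))
    (p : List (X × Y)) {e : ℝ} (he : 0 < e) : ∃ N, areach v G p - e < reach v G N p :=
  exists_lt_of_lt_ciSup (show areach v G p - e < ⨆ N, reach v G N p by
    unfold areach; linarith)

open Classical in
lemma areach_super {v : List (X × Y) → ℝ} (G : Set (List (X × Y))) (hv : ∀ p, 0 ≤ v p)
    (hv1 : ∀ p, v p ≤ 1) (p : List (X × Y)) :
    mval (fun z => if p ++ [z] ∈ G then v (p ++ [z]) else areach v G (p ++ [z])) ≤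
      areach v G p := by
  apply le_of_forall_pos_le_add
  intro e he
  choose N hN using fun z : X × Y => areach_approx (v := v) G (p ++ [z]) he
  let K := Finset.univ.sup N
  have hK : ∀ z, areach v G (p ++ [z]) ≤ reach v G K (p ++ [z]) + e := by
    intro z
    have h1 : reach v G (N z) (p ++ [z]) ≤ reach v G K (p ++ [z]) :=
      reach_mono G hv (p ++ [z]) (Finset.le_sup (f := N) (Finset.mem_univ z))
    linarith [hN z]
  have h2 : reach v G (K + 1) p ≤ areach v G p := le_ciSup (areach_bdd G hv1 p) (K + 1)
  rw [reach] at h2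
  refine le_trans (mval_le (d := e) ?_) (add_le_add_left h2 e)
  intro z
  have := hK z
  split_ifs <;> linarith

open Classical in
/-- Glue functions along the first strict entry into `G`. -/
noncomputable def glue {A : Type} (G : Set (List (X × Y)))
    (W : List (X × Y) → List (X × Y) → A) (base : List (X × Y) → A) :
    List (X × Y) → List (X × Y) → A
  | p, [] => base p
  | p, z :: q => if p ++ [z] ∈ G then W (p ++ [z]) q else glue G W base (p ++ [z]) q

lemma vv_le_areach (D : Set (Play (X × Y))) (G : Set (List (X × Y)))
    (hG : ∀ w ∈ D, ∀ m : ℕ, ∃ r ∈ G, m < r.length ∧ w ∈ cyl r) (p : List (X × Y))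
    (hcyl : ∀ (w : Play (X × Y)) (p r : List (X × Y)), w ∈ cyl p → w ∈ cyl r →
      p.length < r.length → ∃ s, s ≠ [] ∧ r = p ++ s) :
    vv D p ≤ areach (vv D) G p := by
  classical
  apply le_of_forall_pos_le_add
  intro e he
  have hex : ∀ r, ∃ V S, IsCert D r V S ∧ V [] < vv D r + e := by
    intro r
    obtain ⟨c, ⟨V, S, h, rfl⟩, hc⟩ := exists_lt_of_csInf_lt ⟨1, one_mem_certVals D r⟩
      (show sInf (certVals D r) < vv D r + e by unfold vv; linarith)
    exact ⟨V, S, h, hc⟩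
  choose V S hVS hV using hex
  let a := areach (vv D) G
  have ha0 : ∀ p, 0 ≤ a p := fun p =>
    (reach_nonneg G (vv_nonneg D) 0 p).trans (le_ciSup (areach_bdd G (vv_le_one D) p) 0)
  let U := glue G V (fun p => a p + e)
  let T := glue G (fun p q => q ∈ S p) (fun _ => False)
  have hU : U p [] = a p + e := by simp only [U, glue]
  change vv D p ≤ a p + e
  rw [← hU]
  refine csInf_le (certVals_bdd D p) ⟨U p, {q | T p q}, ⟨?_, ?_, ?_, ?_, ?_⟩, rfl⟩
  · intro q
    induction q generalizing p with
    | nil => have := ha0 p; rw [hU]; linarith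
    | cons z q ih =>
      simp only [U, glue]
      split_ifs
      · exact (hVS _).1 _
      · exact ih (p ++ [z]) (by simp only [U, glue])
  · intro q
    induction q generalizing p with
    | nil =>
      rw [hU]
      refine le_trans ?_ (add_le_add_left (areach_super G (vv_nonneg D) (vv_le_one D) p) e)
      apply mval_le
      intro z
      simp only [U, glue, List.nil_append]
      split_ifs
      · exact (hV _).le
      · exact le_rfl
    | cons z q ih =>
      simp only [U, glue, List.cons_append]
      split_ifs
      · exact (hVS _).2.1 _
      · exact ih (p ++ [z]) (by simp only [U, glue])
  · intro q
    induction q generalizing p with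
    | nil => intro h; exact absurd h (by simp [T, glue])
    | cons z q ih =>
      simp only [T, glue, List.cons_append, Set.mem_ofPred_eq]
      split_ifs
      · exact (hVS _).2.2.1 _
      · exact ih (p ++ [z]) (by simp only [U, glue])
  · intro q
    induction q generalizing p with
    | nil => intro h; exact absurd h (by simp [T, glue])
    | cons z q ih =>
      simp only [T, U, glue, Set.mem_ofPred_eq]
      split_ifs
      · exact (hVS _).2.2.2.1 _
      · exact ih (p ++ [z]) (by simp only [U, glue])
  · intro w hw hwp
    obtain ⟨r, hrG, hlen, hwr⟩ := hG w hw p.length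
    obtain ⟨s, hs, rfl⟩ := hcyl w p r hwp hwr hlen
    clear hlen hwp hU
    induction s generalizing p with
    | nil => exact absurd rfl hs
    | cons z s ih =>
      by_cases hz : p ++ [z] ∈ G
      · have hwz : w ∈ cyl (p ++ [z]) := by
          intro i
          have h1 : i.1 < (p ++ z :: s).length := by have := i.2; simp at this ⊢; omega
          rw [hwr ⟨i.1, h1⟩]
          have : p ++ z :: s = (p ++ [z]) ++ s := by simp
          simp only [this, List.get_eq_getElem]
          exact List.getElem_append_left _
        obtain ⟨q, hq, hwq⟩ := (hVS (p ++ [z])).2.2.2.2 w hw hwz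
        refine ⟨z :: q, ?_, by simpa using hwq⟩
        simp only [T, glue, Set.mem_ofPred_eq, if_pos hz]
        exact hq
      · have hs' : s ≠ [] := by
          rintro rfl
          exact hz hrG
        obtain ⟨q, hq, hwq⟩ := ih (p ++ [z]) hs' (by simpa using hrG) (by simpa using hwr)
        refine ⟨z :: q, ?_, by simpa using hwq⟩
        simp only [T, glue, Set.mem_ofPred_eq, if_neg hz]
        exact hq

end Value

section Strat
variable {X Y : Type} [Fintype X] [Nonempty X] [Fintype Y] [Nonempty Y]

/-- Finite-horizon expectation from position `p`. -/
noncomputable def Ex (σ : Strategy (X × Y) X) (τ : Strategy (X × Y) Y)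
    (f : List (X × Y) → ℝ) : ℕ → List (X × Y) → ℝ
  | 0, p => f p
  | n + 1, p => ev (σ p) (τ p) (fun z => Ex σ τ f n (p ++ [z]))

lemma Ex_mono (σ : Strategy (X × Y) X) (τ : Strategy (X × Y) Y)
    {f g : List (X × Y) → ℝ} (h : ∀ p, f p ≤ g p) : ∀ n p, Ex σ τ f n p ≤ Ex σ τ g n p
  | 0, p => h p
  | n + 1, p => ev_mono _ _ fun z => Ex_mono σ τ h n (p ++ [z])

lemma Ex_super (σ : Strategy (X × Y) X) (τ : Strategy (X × Y) Y)
    {f : List (X × Y) → ℝ} (h : ∀ p, ev (σ p) (τ p) (fun z => f (p ++ [z])) ≤ f p) :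
    ∀ n p, Ex σ τ f n p ≤ f p
  | 0, _ => le_rfl
  | n + 1, p => (ev_mono _ _ fun z => Ex_super σ τ h n (p ++ [z])).trans (h p)

lemma Ex_sub (σ : Strategy (X × Y) X) (τ : Strategy (X × Y) Y)
    {f : List (X × Y) → ℝ} (h : ∀ p, f p ≤ ev (σ p) (τ p) (fun z => f (p ++ [z]))) :
    ∀ n p, f p ≤ Ex σ τ f n p
  | 0, _ => le_rfl
  | n + 1, p => (h p).trans (ev_mono _ _ fun z => Ex_sub σ τ h n (p ++ [z]))

def pre {Z : Type} (w : Play Z) (n : ℕ) : List Z := (List.range n).map w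

lemma pre_succ {Z : Type} (w : Play Z) (n : ℕ) : pre w (n + 1) = pre w n ++ [w n] := by
  simp [pre, List.range_succ]

open Classical in
noncomputable def stR {Z : Type} (G : Set (List Z)) (sel : List Z → ℕ → ℕ) : List Z → ℕ × ℕ
  | [] => (sel [] 0, 0)
  | z :: r => if (z :: r).reverse ∈ G then (sel (z :: r).reverse ((stR G sel r).2 + 1),
      (stR G sel r).2 + 1) else ((stR G sel r).1 - 1, (stR G sel r).2)

noncomputable def st {Z : Type} (G : Set (List Z)) (sel : List Z → ℕ → ℕ) (p : List Z) : ℕ × ℕ :=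
  stR G sel p.reverse

open Classical in
lemma st_snoc {Z : Type} (G : Set (List Z)) (sel : List Z → ℕ → ℕ) (p : List Z) (z : Z) :
    st G sel (p ++ [z]) = if p ++ [z] ∈ G then (sel (p ++ [z]) ((st G sel p).2 + 1),
      (st G sel p).2 + 1) else ((st G sel p).1 - 1, (st G sel p).2) := by
  simp [st, stR]

lemma playerI (G : Set (List (X × Y))) (v : List (X × Y) → ℝ) (hv0 : ∀ p, 0 ≤ v p)
    (hv1 : ∀ p, v p ≤ 1) (hva : ∀ p, v p ≤ areach v G p) {e : ℝ} (he : 0 < e) :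
    ∃ (σ : Strategy (X × Y) X) (Good : Set (List (X × Y))),
      (∀ τ n, v [] - 2 * e ≤ Ex σ τ (Good.indicator fun _ => 1) n []) ∧
      ∀ w : Play (X × Y), (∀ m, ∃ n, m ≤ n ∧ pre w n ∈ Good) → ∀ m, ∃ n, m < n ∧ pre w n ∈ G := by
  classical
  have hsel : ∀ p (k : ℕ), ∃ N, v p - e / 2 ^ k ≤ reach v G N p := by
    intro p k
    obtain ⟨N, hN⟩ := areach_approx (v := v) G p (show 0 < e / 2 ^ k by positivity)
    exact ⟨N, by linarith [hva p]⟩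
  choose sel hsel using hsel
  let s := st G sel
  let M : List (X × Y) → X × Y → ℝ := fun p z =>
    if p ++ [z] ∈ G then v (p ++ [z]) else reach v G ((s p).1 - 1) (p ++ [z])
  let W : List (X × Y) → ℝ := fun p => reach v G (s p).1 p - e / 2 ^ (s p).2
  refine ⟨fun p => optX (M p), {p | 0 < (s p).1}, ?_, ?_⟩
  · intro τ n
    have hW0 : v [] - 2 * e ≤ W [] := by
      have := hsel [] 0
      simp only [W, s, st, stR, List.reverse_nil]
      simp only [pow_zero, div_one] at this ⊢
      linarith
    have hsub := Ex_sub (fun p => optX (M p)) τ (f := W) (by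
      intro p
      have hchild : ∀ z, M p z - e / 2 ^ (s p).2 ≤ W (p ++ [z]) := by
        intro z
        simp only [M, W, s, st_snoc]
        split_ifs with hz
        · have := hsel (p ++ [z]) ((st G sel p).2 + 1)
          have h2 : e / 2 ^ (st G sel p).2 = e / 2 ^ ((st G sel p).2 + 1)
              + e / 2 ^ ((st G sel p).2 + 1) := by
            rw [pow_succ]; field_simp; ring
          simp only
          linarith
        · exact le_rfl
      have h1 : reach v G (s p).1 p ≤ ev (optX (M p)) (τ p) (M p) := by
        refine le_trans ?_ (mval_le_ev (M p) (τ p))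
        rcases hN : (s p).1 with _ | N
        · have h0 := mval_le (X := X) (Y := Y) (d := 0) (M := fun _ => 0) (M' := M p) (by
            intro z
            have := reach_nonneg G hv0 ((s p).1 - 1) (p ++ [z])
            have := hv0 (p ++ [z])
            simp only [M]
            split_ifs <;> linarith)
          rw [mval_const] at h0
          simp only [reach]
          linarith
        · rw [reach]
          simp only [M, hN, Nat.add_sub_cancel]
          exact le_rfl
      have h2 := ev_mono (optX (M p)) (τ p) hchild
      simp only [sub_eq_add_neg] at h2
      rw [ev_add] at h2
      simp only [W] at h2 ⊢
      linarith) n []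
    refine hW0.trans (hsub.trans (Ex_mono _ _ ?_ n []))
    intro p
    simp only [W, Set.indicator, Set.mem_ofPred_eq]
    have hpos : 0 < e / 2 ^ (s p).2 := by positivity
    split_ifs with h
    · linarith [reach_le_one G hv1 (s p).1 p]
    · have : (s p).1 = 0 := by omega
      rw [this, reach]
      linarith
  · intro w hw
    by_contra! hcon
    obtain ⟨m, hm⟩ := hcon
    have key : ∀ j, (s (pre w (m + j))).1 = (s (pre w m)).1 - j := by
      intro j
      induction j with
      | zero => simp
      | succ j ih =>
        have h1 := hm (m + j + 1) (by omega)
        rw [pre_succ] at h1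
        rw [← add_assoc, pre_succ]
        simp only [s] at ih ⊢
        rw [st_snoc, if_neg h1]
        simp only
        omega
    obtain ⟨n, hn, hg⟩ := hw (m + (s (pre w m)).1)
    have := key (n - m)
    rw [show m + (n - m) = n by omega] at this
    simp only [Set.mem_ofPred_eq] at hg
    omega

end Strat

section Meas

lemma pre_length {Z : Type} (w : Play Z) (n : ℕ) : (pre w n).length = n := by simp [pre]

lemma mem_cyl {Z : Type} (w : Play Z) (p : List Z) : w ∈ cyl p ↔ pre w p.length = p := by
  constructor
  · intro h
    apply List.ext_getElem
    · simp [pre]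
    · intro i h1 h2
      have := h ⟨i, h2⟩
      simpa [pre] using this
  · intro h i
    have hi : i.1 < (pre w p.length).length := by rw [pre_length]; exact i.2
    have h1 : (pre w p.length)[i.1]'hi = w i.1 := by simp [pre]
    rw [← h1]
    simp only [List.get_eq_getElem, h]

lemma pre_take {Z : Type} (w : Play Z) {m n : ℕ} (h : m ≤ n) : (pre w n).take m = pre w m := by
  simp [pre, ← List.map_take, List.take_range, h]

lemma mem_cyl_pre {Z : Type} (w : Play Z) (n : ℕ) : w ∈ cyl (pre w n) := by
  rw [mem_cyl, pre_length]

lemma cyl_split {Z : Type} (w : Play Z) (p r : List Z) (hp : w ∈ cyl p) (hr : w ∈ cyl r)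
    (h : p.length < r.length) : ∃ s, s ≠ [] ∧ r = p ++ s := by
  rw [mem_cyl] at hp hr
  refine ⟨r.drop p.length, ?_, ?_⟩
  · intro h0
    have := congrArg List.length h0
    simp at this
    omega
  · have h1 : r.take p.length = p := by
      rw [← hr, pre_take w h.le, hp]
    conv_lhs => rw [← List.take_append_drop p.length r, h1]

lemma cyl_snoc_iff {Z : Type} (w : Play Z) (p : List Z) (z : Z) :
    w ∈ cyl (p ++ [z]) ↔ w ∈ cyl p ∧ w p.length = z := by
  rw [mem_cyl, mem_cyl, List.length_append, List.length_singleton, pre_succ]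
  constructor
  · intro h
    have := List.append_inj' h rfl
    exact ⟨this.1, by simpa using this.2⟩
  · rintro ⟨h1, h2⟩
    rw [h1, h2]

lemma isOpen_cyl {Z : Type} [TopologicalSpace Z] [DiscreteTopology Z] (p : List Z) :
    IsOpen (cyl p) := by
  have : cyl p = ⋂ i : Fin p.length, (fun w : Play Z => w i.1) ⁻¹' {p.get i} := by
    ext w; simp [cyl]
  rw [this]
  exact isOpen_iInter_of_finite fun i => (isOpen_discrete _).preimage (continuous_apply _)

lemma measurableSet_cyl {Z : Type} [MeasurableSpace Z] [MeasurableSingletonClass Z] (p : List Z) :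
    MeasurableSet (cyl p) := by
  have : cyl p = ⋂ i : Fin p.length, (fun w : Play Z => w i.1) ⁻¹' {p.get i} := by
    ext w; simp [cyl]
  rw [this]
  exact MeasurableSet.iInter fun i => (measurableSet_singleton _).preimage (measurable_pi_apply _)

lemma measurableSet_lev {Z : Type} [Finite Z] [MeasurableSpace Z] [MeasurableSingletonClass Z]
    (P : Set (List Z)) (n : ℕ) : MeasurableSet {w : Play Z | pre w n ∈ P} := by
  have : {w : Play Z | pre w n ∈ P} = ⋃ p ∈ {p : List Z | p ∈ P ∧ p.length = n}, cyl p := by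
    ext w
    simp only [Set.mem_ofPred_eq, Set.mem_iUnion, mem_cyl]
    constructor
    · intro h
      exact ⟨pre w n, ⟨h, pre_length w n⟩, by rw [pre_length]⟩
    · rintro ⟨p, ⟨h, hl⟩, h2⟩
      rw [hl] at h2
      rwa [h2]
  rw [this]
  exact MeasurableSet.biUnion (Set.to_countable _) fun p _ => measurableSet_cyl p

lemma open_pre {Z : Type} [TopologicalSpace Z] {O : Set (Play Z)} (hO : IsOpen O) {w : Play Z}
    (hw : w ∈ O) : ∃ N, ∀ n, N ≤ n → cyl (pre w n) ⊆ O := by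
  obtain ⟨I, u, hu, hsub⟩ := isOpen_pi_iff.1 hO w hw
  refine ⟨I.sup id + 1, fun n hn w' hw' => hsub ?_⟩
  intro i hi
  have hin : i < n := by
    have : i ≤ I.sup id := Finset.le_sup (f := id) hi
    omega
  have := hw' ⟨i, by rw [pre_length]; exact hin⟩
  simp [pre] at this
  rw [this]
  exact (hu i hi).2

open Classical in
/-- Number of open sets entered so far (on reversed positions). -/
noncomputable def lvR {Z : Type} (O : ℕ → Set (Play Z)) : List Z → ℕ
  | [] => 0
  | z :: r => if cyl (z :: r).reverse ⊆ O (lvR O r) then lvR O r + 1 else lvR O r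

lemma buchi {Z : Type} [TopologicalSpace Z] {D : Set (Play Z)} (hD : IsGδ D) :
    ∃ G : Set (List Z), ∀ w, w ∈ D ↔ ∀ m, ∃ n, m < n ∧ pre w n ∈ G := by
  classical
  obtain ⟨O, hO, rfl⟩ := isGδ_iff_eq_iInter_nat.1 hD
  let lv : List Z → ℕ := fun p => lvR O p.reverse
  have hlv : ∀ p z, lv (p ++ [z]) = if cyl (p ++ [z]) ⊆ O (lv p) then lv p + 1 else lv p := by
    intro p z
    simp [lv, lvR]
  refine ⟨{q | ∃ p z, q = p ++ [z] ∧ cyl q ⊆ O (lv p)}, fun w => ?_⟩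
  have hG : ∀ n, pre w (n + 1) ∈ {q | ∃ p z, q = p ++ [z] ∧ cyl q ⊆ O (lv p)} ↔
      cyl (pre w (n + 1)) ⊆ O (lv (pre w n)) := by
    intro n
    constructor
    · rintro ⟨p, z, h1, h2⟩
      rw [pre_succ w n] at h1
      rwa [(List.append_inj' h1 rfl).1]
    · intro h
      exact ⟨pre w n, w n, pre_succ w n, h⟩
  constructor
  · intro hw m
    by_contra! hcon
    have hst : ∀ j, lv (pre w (m + j)) = lv (pre w m) := by
      intro j
      induction j with
      | zero => rfl
      | succ j ih =>
        have h1 := hcon (m + j + 1) (by omega)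
        rw [hG, pre_succ] at h1
        rw [← add_assoc, pre_succ, hlv, if_neg h1, ih]
    obtain ⟨N, hN⟩ := open_pre (hO (lv (pre w m))) (Set.mem_iInter.1 hw _)
    apply hcon (m + N + 1) (by omega)
    rw [hG, hst]
    exact hN _ (by omega)
  · intro h
    have hin : ∀ n k, k < lv (pre w n) → w ∈ O k := by
      intro n
      induction n with
      | zero => intro k hk; simp [pre, lv, lvR] at hk
      | succ n ih =>
        intro k hk
        rw [pre_succ, hlv] at hk
        split_ifs at hk with hc
        · rcases Nat.lt_succ_iff_lt_or_eq.1 hk with h1 | h1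
          · exact ih k h1
          · rw [h1]
            apply hc
            rw [← pre_succ]
            exact mem_cyl_pre w _
        · exact ih k hk
    have hmono : Monotone fun n => lv (pre w n) := by
      apply monotone_nat_of_le_succ
      intro n
      rw [pre_succ, hlv]
      split_ifs <;> omega
    have hunb : ∀ k, ∃ n, k ≤ lv (pre w n) := by
      intro k
      induction k with
      | zero => exact ⟨0, Nat.zero_le _⟩
      | succ k ih =>
        obtain ⟨m, hm⟩ := ih
        obtain ⟨n, hmn, hn⟩ := h m
        obtain ⟨n', rfl⟩ : ∃ n', n = n' + 1 := ⟨n - 1, by omega⟩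
        refine ⟨n' + 1, ?_⟩
        rw [hG, pre_succ] at hn
        rw [pre_succ, hlv, if_pos hn]
        have := hmono (show m ≤ n' by omega)
        simp only at this
        omega
    rw [Set.mem_iInter]
    intro k
    obtain ⟨n, hn⟩ := hunb (k + 1)
    exact hin n k (by omega)

lemma cylProb_snoc {X Y : Type} (σ : Strategy (X × Y) X) (τ : Strategy (X × Y) Y)
    (p : List (X × Y)) (z : X × Y) :
    cylProb σ τ (p ++ [z]) = cylProb σ τ p * (σ p z.1 * τ p z.2) := by
  have h : p.length + 1 = (p ++ [z]).length := by simp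
  unfold cylProb
  rw [← (finCongr h).prod_comp, Fin.prod_univ_castSucc]
  congr 1
  · refine Finset.prod_congr rfl fun i _ => ?_
    have h1 : (p ++ [z]).take i.1 = p.take i.1 := List.take_append_of_le_length i.2.le
    simp [h1]
  · simp

lemma cylProb_singleton {X Y : Type} (σ : Strategy (X × Y) X) (τ : Strategy (X × Y) Y)
    (z : X × Y) : cylProb σ τ [z] = σ [] z.1 * τ [] z.2 := by
  have := cylProb_snoc σ τ [] z
  simpa [cylProb] using this

lemma singleton_class {X Y : Type} [Fintype X] [Fintype Y]
    [MeasurableSpace X] [MeasurableSpace Y]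
    (μ : Strategy (X × Y) X → Strategy (X × Y) Y → Measure (Play (X × Y)))
    (hμ : ∀ σ τ, IsInduced σ τ (μ σ τ)) : MeasurableSingletonClass (X × Y) := by
  classical
  have hsep : ∀ z z' : X × Y, z' ≠ z → ∃ s : Set (X × Y), MeasurableSet s ∧ z ∈ s ∧ z' ∉ s := by
    intro z z' hne
    by_contra! hcon
    have hiff : ∀ s : Set (X × Y), MeasurableSet s → (z ∈ s ↔ z' ∈ s) := by
      intro s hs
      refine ⟨hcon s hs, fun h => ?_⟩
      by_contra h1
      exact hcon sᶜ hs.compl h1 h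
    let σ : Strategy (X × Y) X := fun _ => PMF.pure z.1
    let τ : Strategy (X × Y) Y := fun _ => PMF.pure z.2
    have h1 : μ σ τ (cyl [z]) = 1 := by
      rw [(hμ σ τ).2, cylProb_singleton]
      simp [σ, τ]
    have h0 : μ σ τ (cyl [z']) = 0 := by
      rw [(hμ σ τ).2, cylProb_singleton]
      simp only [σ, τ, PMF.pure_apply]
      by_cases hx : z'.1 = z.1
      · have hy : z'.2 ≠ z.2 := fun hy => hne (Prod.ext hx hy)
        simp [hy]
      · simp [hx]
    have hsub : cyl [z] ⊆ toMeasurable (μ σ τ) (cyl [z']) := by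
      intro w hw
      have hwz : w 0 = z := by simpa using hw ⟨0, by simp⟩
      let F : Bool → Play (X × Y) := fun b => Function.update w 0 (if b then z else z')
      have hF : @Measurable Bool _ ⊥ _ F := by
        let _ : MeasurableSpace Bool := ⊥
        rw [measurable_pi_iff]
        intro i
        by_cases hi : i = 0
        · subst hi
          intro s hs
          rw [MeasurableSpace.measurableSet_bot_iff]
          have := hiff s hs
          by_cases hz : z ∈ s
          · right
            ext b; cases b <;> simp [F, hz, this.1 hz]
          · left
            have hz' : z' ∉ s := fun h => hz (this.2 h)
            ext b; cases b <;> simp [F, hz, hz']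
        · simp only [F, Function.update_of_ne hi]
          exact measurable_const
      have hm := hF (measurableSet_toMeasurable (μ σ τ) (cyl [z']))
      rw [MeasurableSpace.measurableSet_bot_iff] at hm
      have hfalse : false ∈ F ⁻¹' toMeasurable (μ σ τ) (cyl [z']) := by
        apply subset_toMeasurable
        intro i
        simp [F]
      have htrue : true ∈ F ⁻¹' toMeasurable (μ σ τ) (cyl [z']) := by
        rcases hm with hm | hm
        · rw [hm] at hfalse; exact absurd hfalse (by simp)
        · rw [hm]; trivial
      have hFt : F true = w := by
        simp only [F, if_true, ← hwz]
        exact Function.update_eq_self 0 w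
      rw [Set.mem_preimage, hFt] at htrue
      exact htrue
    have := measure_mono (μ := μ σ τ) hsub
    rw [h1, measure_toMeasurable, h0] at this
    exact absurd this (by simp)
  constructor
  intro z
  choose s hs hz hz' using hsep z
  have : ({z} : Set (X × Y)) = ⋂ z' : X × Y, ⋂ h : z' ≠ z, s z' h := by
    ext t
    simp only [Set.mem_singleton_iff, Set.mem_iInter]
    constructor
    · rintro rfl z' h
      exact hz z' h
    · intro h
      by_contra ht
      exact hz' t ht (h t ht)
  rw [this]
  exact MeasurableSet.iInter fun z' => MeasurableSet.iInter fun h => hs z' h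

variable {X Y : Type} [Fintype X] [Nonempty X] [Fintype Y] [Nonempty Y]
    [MeasurableSpace X] [MeasurableSpace Y] [MeasurableSingletonClass (X × Y)]

lemma real_lev_aux {σ : Strategy (X × Y) X} {τ : Strategy (X × Y) Y}
    {ν : Measure (Play (X × Y))} (h : IsInduced σ τ ν) (P : Set (List (X × Y))) :
    ∀ (n : ℕ) (p : List (X × Y)), ν.real (cyl p ∩ {w | pre w (p.length + n) ∈ P}) =
      ν.real (cyl p) * Ex σ τ (P.indicator fun _ => 1) n p
  | 0, p => by
      by_cases hp : p ∈ P
      · have : cyl p ∩ {w | pre w (p.length + 0) ∈ P} = cyl p := by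
          apply Set.inter_eq_left.2
          intro w hw
          rw [mem_cyl] at hw
          simpa [hw] using hp
        rw [this]
        simp [Ex, hp]
      · have : cyl p ∩ {w | pre w (p.length + 0) ∈ P} = ∅ := by
          apply Set.eq_empty_of_forall_notMem
          rintro w ⟨hw, hw2⟩
          rw [mem_cyl] at hw
          simp [hw] at hw2
          exact hp hw2
        rw [this]
        simp [Ex, hp]
  | n + 1, p => by
      have := h.1
      have hset : cyl p ∩ {w | pre w (p.length + (n + 1)) ∈ P} =
          ⋃ z : X × Y, cyl (p ++ [z]) ∩ {w | pre w ((p ++ [z]).length + n) ∈ P} := by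
        ext w
        simp only [Set.mem_inter_iff, Set.mem_iUnion, cyl_snoc_iff, Set.mem_ofPred_eq,
          List.length_append, List.length_singleton]
        rw [show p.length + (n + 1) = p.length + 1 + n by omega]
        constructor
        · rintro ⟨h1, h2⟩
          exact ⟨_, ⟨h1, rfl⟩, h2⟩
        · rintro ⟨z, ⟨h1, _⟩, h2⟩
          exact ⟨h1, h2⟩
      rw [hset, measureReal_iUnion_fintype]
      · simp only [Ex, ev, Finset.mul_sum]
        refine Finset.sum_congr rfl fun z _ => ?_
        rw [real_lev_aux h P n (p ++ [z])]
        have : ν.real (cyl (p ++ [z])) = ν.real (cyl p) * ((σ p z.1).toReal * (τ p z.2).toReal) := by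
          simp only [Measure.real, h.2, cylProb_snoc, ENNReal.toReal_mul]
        rw [this]
        ring
      · intro z z' hne
        apply Set.disjoint_left.2
        rintro w ⟨h1, _⟩ ⟨h2, _⟩
        rw [cyl_snoc_iff] at h1 h2
        exact hne (h1.2.symm.trans h2.2)
      · intro z
        exact (measurableSet_cyl _).inter (measurableSet_lev _ _)

lemma real_lev {σ : Strategy (X × Y) X} {τ : Strategy (X × Y) Y}
    {ν : Measure (Play (X × Y))} (h : IsInduced σ τ ν) (P : Set (List (X × Y))) (n : ℕ) :
    ν.real {w | pre w n ∈ P} = Ex σ τ (P.indicator fun _ => 1) n [] := by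
  have := h.1
  have h1 := real_lev_aux h P n []
  have h2 : cyl ([] : List (X × Y)) = Set.univ := by ext w; simp [cyl]
  simpa [h2] using h1

/-- Player II's side. -/
lemma upper (μ : Strategy (X × Y) X → Strategy (X × Y) Y → Measure (Play (X × Y)))
    (hμ : ∀ σ τ, IsInduced σ τ (μ σ τ)) {D : Set (Play (X × Y))} {V : List (X × Y) → ℝ}
    {S : Set (List (X × Y))} (hc : IsCert D [] V S) :
    ∃ τ, ∀ σ, (μ σ τ).real {w | ∃ q ∈ S, w ∈ cyl q} ≤ V [] := by
  obtain ⟨h0, hsup, hup, h1, -⟩ := hc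
  refine ⟨fun p => optY (fun z => V (p ++ [z])), fun σ => ?_⟩
  set τ : Strategy (X × Y) Y := fun p => optY (fun z => V (p ++ [z])) with hτ
  have := (hμ σ τ).1
  have hn : ∀ n, (μ σ τ).real {w | pre w n ∈ S} ≤ V [] := by
    intro n
    rw [real_lev (hμ σ τ)]
    refine (Ex_mono σ τ (g := V) ?_ n []).trans (Ex_super σ τ ?_ n [])
    · intro p
      by_cases hp : p ∈ S
      · simpa [hp] using h1 p hp
      · simpa [hp] using h0 p
    · intro p
      exact (ev_le_mval _ _).trans (hsup p)
  have hset : {w | ∃ q ∈ S, w ∈ cyl q} = ⋃ n, {w : Play (X × Y) | pre w n ∈ S} := by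
    ext w
    simp only [Set.mem_ofPred_eq, Set.mem_iUnion]
    constructor
    · rintro ⟨q, hq, hw⟩
      rw [mem_cyl] at hw
      exact ⟨q.length, by rwa [hw]⟩
    · rintro ⟨n, hn⟩
      exact ⟨_, hn, mem_cyl_pre w n⟩
  have hmono : Monotone fun n => {w : Play (X × Y) | pre w n ∈ S} := by
    apply monotone_nat_of_le_succ
    intro n w hw
    simp only [Set.mem_ofPred_eq] at hw ⊢
    rw [pre_succ]
    exact hup _ hw _
  have hlim := (ENNReal.tendsto_toReal (measure_ne_top (μ σ τ) _)).comp
    (tendsto_measure_iUnion_atTop (μ := μ σ τ) hmono)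
  rw [hset]
  exact le_of_tendsto' hlim hn

/-- Player I's side. -/
lemma lower [TopologicalSpace X] [DiscreteTopology X] [TopologicalSpace Y] [DiscreteTopology Y]
    (μ : Strategy (X × Y) X → Strategy (X × Y) Y → Measure (Play (X × Y)))
    (hμ : ∀ σ τ, IsInduced σ τ (μ σ τ)) {D : Set (Play (X × Y))} (hD : IsGδ D)
    {e : ℝ} (he : 0 < e) : ∃ σ, ∀ τ, vv D [] - 2 * e ≤ (μ σ τ).real D := by
  obtain ⟨G, hG⟩ := buchi hD
  have hva : ∀ p, vv D p ≤ areach (vv D) G p := by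
    intro p
    refine vv_le_areach D G ?_ p cyl_split
    intro w hw m
    obtain ⟨n, hmn, hn⟩ := (hG w).1 hw m
    exact ⟨pre w n, hn, by rwa [pre_length], mem_cyl_pre w n⟩
  obtain ⟨σ, Good, h1, h2⟩ := playerI G (vv D) (vv_nonneg D) (vv_le_one D) hva he
  refine ⟨σ, fun τ => ?_⟩
  have := (hμ σ τ).1
  let A : ℕ → Set (Play (X × Y)) := fun m => ⋃ n, ⋃ _ : m ≤ n, {w | pre w n ∈ Good}
  have hAm : ∀ m, MeasurableSet (A m) := fun m =>
    MeasurableSet.iUnion fun n => MeasurableSet.iUnion fun _ => measurableSet_lev _ _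
  have hAanti : Antitone A := by
    intro m m' hm w hw
    simp only [A, Set.mem_iUnion] at hw ⊢
    obtain ⟨n, hn, hw⟩ := hw
    exact ⟨n, hm.trans hn, hw⟩
  have hA : ∀ m, vv D [] - 2 * e ≤ (μ σ τ).real (A m) := by
    intro m
    have h3 := h1 τ m
    rw [← real_lev (hμ σ τ)] at h3
    refine h3.trans (measureReal_mono ?_ (measure_ne_top _ _))
    intro w hw
    simp only [A, Set.mem_iUnion]
    exact ⟨m, le_rfl, hw⟩
  have hsub : ⋂ m, A m ⊆ D := by
    intro w hw
    rw [hG]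
    apply h2
    intro m
    have := Set.mem_iInter.1 hw m
    simp only [A, Set.mem_iUnion] at this
    obtain ⟨n, hn, hw⟩ := this
    exact ⟨n, hn, hw⟩
  have hlim := (ENNReal.tendsto_toReal (measure_ne_top (μ σ τ) _)).comp
    (tendsto_measure_iInter_atTop (μ := μ σ τ) (fun i => (hAm i).nullMeasurableSet) hAanti
      ⟨0, measure_ne_top _ _⟩)
  exact (ge_of_tendsto' hlim hA).trans (measureReal_mono hsub (measure_ne_top _ _))

end Meas

end BW

/-- Blackwell games on Gδ sets are determined, and the value is the infimum of
the values on open supersets. -/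
theorem stmt_18 {X Y : Type} [Fintype X] [Nonempty X] [Fintype Y] [Nonempty Y]
    [MeasurableSpace X] [MeasurableSpace Y]
    [TopologicalSpace X] [DiscreteTopology X]
    [TopologicalSpace Y] [DiscreteTopology Y]
    (μ : Strategy (X × Y) X → Strategy (X × Y) Y → Measure (Play (X × Y)))
    (hμ : ∀ σ τ, IsInduced σ τ (μ σ τ))
    (D : Set (Play (X × Y))) (hD : IsGδ D) :
    (⨆ σ, ⨅ τ, (μ σ τ D).toReal) = (⨅ τ, ⨆ σ, (μ σ τ D).toReal) ∧
    (⨆ σ, ⨅ τ, (μ σ τ D).toReal) =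
      ⨅ O : {O : Set (Play (X × Y)) // IsOpen O ∧ D ⊆ O},
        ⨆ σ, ⨅ τ, (μ σ τ (O : Set (Play (X × Y)))).toReal := by
  have hsc := BW.singleton_class μ hμ
  have hprob : ∀ σ τ, IsProbabilityMeasure (μ σ τ) := fun σ τ => (hμ σ τ).1
  have : Nonempty (Strategy (X × Y) X) := ⟨fun _ => PMF.pure (Classical.arbitrary X)⟩
  have : Nonempty (Strategy (X × Y) Y) := ⟨fun _ => PMF.pure (Classical.arbitrary Y)⟩
  have hle1 : ∀ σ τ (E : Set (Play (X × Y))), (μ σ τ E).toReal ≤ 1 :=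
    fun σ τ E => measureReal_le_one
  have hb1 : ∀ σ (E : Set (Play (X × Y))), BddBelow (Set.range fun τ => (μ σ τ E).toReal) := by
    intro σ E
    refine ⟨0, ?_⟩
    rintro _ ⟨τ, rfl⟩
    exact ENNReal.toReal_nonneg
  have hb2 : ∀ τ (E : Set (Play (X × Y))), BddAbove (Set.range fun σ => (μ σ τ E).toReal) := by
    intro τ E
    refine ⟨1, ?_⟩
    rintro _ ⟨σ, rfl⟩
    exact hle1 σ τ E
  have hb3 : ∀ E : Set (Play (X × Y)),
      BddAbove (Set.range fun σ => ⨅ τ, (μ σ τ E).toReal) := by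
    intro E
    refine ⟨1, ?_⟩
    rintro _ ⟨σ, rfl⟩
    exact (ciInf_le (hb1 σ E) (Classical.arbitrary _)).trans (hle1 _ _ _)
  have hb4 : ∀ E : Set (Play (X × Y)),
      BddBelow (Set.range fun τ => ⨆ σ, (μ σ τ E).toReal) := by
    intro E
    refine ⟨0, ?_⟩
    rintro _ ⟨τ, rfl⟩
    exact ENNReal.toReal_nonneg.trans (le_ciSup (hb2 τ E) (Classical.arbitrary _))
  have hb5 : BddBelow (Set.range fun O : {O : Set (Play (X × Y)) // IsOpen O ∧ D ⊆ O} =>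
      ⨆ σ, ⨅ τ, (μ σ τ (O : Set (Play (X × Y)))).toReal) := by
    refine ⟨0, ?_⟩
    rintro _ ⟨O, rfl⟩
    exact (le_ciInf fun τ => ENNReal.toReal_nonneg).trans
      (le_ciSup (hb3 O) (Classical.arbitrary _))
  have : Nonempty {O : Set (Play (X × Y)) // IsOpen O ∧ D ⊆ O} :=
    ⟨⟨Set.univ, isOpen_univ, Set.subset_univ _⟩⟩
  -- weak duality
  have hweak : ∀ E : Set (Play (X × Y)),
      (⨆ σ, ⨅ τ, (μ σ τ E).toReal) ≤ ⨅ τ, ⨆ σ, (μ σ τ E).toReal := fun E =>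
    ciSup_le fun σ => le_ciInf fun τ => (ciInf_le (hb1 σ E) τ).trans (le_ciSup (hb2 τ E) σ)
  -- the lower value is at least `vv D []`
  have hlow : BW.vv D [] ≤ ⨆ σ, ⨅ τ, (μ σ τ D).toReal := by
    apply le_of_forall_pos_le_add
    intro e he
    obtain ⟨σ, hσ⟩ := BW.lower μ hμ hD (half_pos he)
    have h1 : BW.vv D [] - 2 * (e / 2) ≤ ⨅ τ, (μ σ τ D).toReal := le_ciInf hσ
    have h2 := le_ciSup (hb3 D) σ
    linarith
  -- every certificate bounds the upper value of an open superset
  have hcert : ∀ V S, BW.IsCert D [] V S → ∃ O : Set (Play (X × Y)), IsOpen O ∧ D ⊆ O ∧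
      (⨅ τ, ⨆ σ, (μ σ τ O).toReal) ≤ V [] := by
    intro V S hc
    refine ⟨{w | ∃ q ∈ S, w ∈ cyl q}, ?_, ?_, ?_⟩
    · have : {w : Play (X × Y) | ∃ q ∈ S, w ∈ cyl q} = ⋃ q ∈ S, cyl q := by
        ext w; simp
      rw [this]
      exact isOpen_biUnion fun q _ => BW.isOpen_cyl q
    · intro w hw
      simpa using hc.2.2.2.2 w hw (by simp [cyl])
    · obtain ⟨τ, hτ⟩ := BW.upper μ hμ hc
      exact (ciInf_le (hb4 _) τ).trans (ciSup_le hτ)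
  have hupD : (⨅ τ, ⨆ σ, (μ σ τ D).toReal) ≤ BW.vv D [] := by
    refine le_csInf ⟨1, BW.one_mem_certVals D []⟩ ?_
    rintro _ ⟨V, S, hc, rfl⟩
    obtain ⟨O, _, hDO, hV⟩ := hcert V S hc
    refine le_trans ?_ hV
    exact ciInf_mono (hb4 D) fun τ => ciSup_mono (hb2 τ O) fun σ => measureReal_mono hDO
  have hdet := le_antisymm (hweak D) (hupD.trans hlow)
  refine ⟨hdet, le_antisymm ?_ ?_⟩
  · refine le_ciInf fun O => ?_
    exact ciSup_mono (hb3 O) fun σ => ciInf_mono (hb1 σ D) fun τ => measureReal_mono O.2.2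
  · refine le_trans ?_ hlow
    refine le_csInf ⟨1, BW.one_mem_certVals D []⟩ ?_
    rintro _ ⟨V, S, hc, rfl⟩
    obtain ⟨O, hO, hDO, hV⟩ := hcert V S hc
    exact (ciInf_le hb5 ⟨O, hO, hDO⟩).trans ((hweak O).trans hV)
end
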